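/- Let U ⊂ ℝ^n and V ⊂ ℝ^d be compact sets containing 0 in their convex hulls, and let Θ̃(X) = min over factorizations X = U'V'ᵀ of (1/2)[γ_{P_V}(V'V'ᵀ) + γ_{P_U}(U'U'ᵀ)]. Then for all X, Y ∈ ℝ^{n×d}: (i) Θ̃(X) = inf over symmetric M ∈ S_n, N ∈ S_d with [[M, X],[Xᵀ, N]] ⪰ 0 of (1/2)γ_{P_U}(M) + (1/2)γ_{P_V}(N); (ii) Θ̃(X) = sup over Q ∈ P_U°, S ∈ P_V°, Z ∈ ℝ^{n×d} with [[Q, Z],[Zᵀ, S]] ⪰ 0 of tr(ZᵀX); (iii) Θ̃°(Y) = inf over Q ∈ S_n, S ∈ S_d with [[Q, Y],[Yᵀ, S]] ⪰ 0 of (1/2)γ_{P_U°}(Q) + (1/2)γ_{P_V°}(S); (iv) Θ̃°(Y) = sup over M ∈ P_U°°, N ∈ P_V°°, Z ∈ ℝ^{n×d} with [[M, Z],[Zᵀ, N]] ⪰ 0 of tr(ZᵀY). -/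

import Mathlib

open Matrix Set ENNReal NNReal Pointwise

noncomputable section

/-- The closed convex hull of `C ∪ {0}`. -/
def cvx {E : Type*} [AddCommGroup E] [Module ℝ E] [TopologicalSpace E] (C : Set E) : Set E :=
  closure (convexHull ℝ (insert 0 C))

/-- The (possibly infinite) gauge of the closed convex hull of `C ∪ {0}`. -/
def gaugeE {E : Type*} [AddCommGroup E] [Module ℝ E] [TopologicalSpace E] (C : Set E) (x : E) :
    ℝ≥0∞ :=
  ⨅ (r : ℝ≥0) (_ : x ∈ (r : ℝ) • cvx C), (r : ℝ≥0∞)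

/-- One-sided polar in the space of symmetric matrices, with the trace pairing. -/
def symPolar {m : ℕ} (C : Set (Matrix (Fin m) (Fin m) ℝ)) : Set (Matrix (Fin m) (Fin m) ℝ) :=
  {N | N.IsSymm ∧ ∀ M ∈ C, (M * N).trace ≤ 1}

/-- `P_U = {u uᵀ : u ∈ U}`. -/
def PU {m : ℕ} (U : Set (Fin m → ℝ)) : Set (Matrix (Fin m) (Fin m) ℝ) :=
  (fun u => vecMulVec u u) '' U

/-- `Θ̃(X) = min over factorizations X = U' V'ᵀ of (1/2)[γ_{P_V}(V' V'ᵀ) + γ_{P_U}(U' U'ᵀ)]`. -/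
def ThetaTilde {n d : ℕ} (U : Set (Fin n → ℝ)) (V : Set (Fin d → ℝ))
    (X : Matrix (Fin n) (Fin d) ℝ) : ℝ≥0∞ :=
  sInf {t : ℝ≥0∞ | ∃ (r : ℕ) (U' : Matrix (Fin n) (Fin r) ℝ) (V' : Matrix (Fin d) (Fin r) ℝ),
    X = U' * V'ᵀ ∧ t = (gaugeE (PU V) (V' * V'ᵀ) + gaugeE (PU U) (U' * U'ᵀ)) / 2}

/-- The polar gauge: `γ°(Y) = sup {tr(Xᵀ Y) : γ(X) ≤ 1}`. -/
def polarGauge {n d : ℕ} (γ : Matrix (Fin n) (Fin d) ℝ → ℝ≥0∞)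
    (Y : Matrix (Fin n) (Fin d) ℝ) : ℝ≥0∞ :=
  ⨆ X ∈ {X | γ X ≤ 1}, ENNReal.ofReal ((Xᵀ * Y).trace)

theorem w_lcs (m n : ℕ) : LocallyConvexSpace ℝ (Matrix (Fin m) (Fin n) ℝ) :=
  inferInstanceAs (LocallyConvexSpace ℝ (Fin m → Fin n → ℝ))

/-- quadratic form -/
theorem tr_vec {m n : ℕ} (u : Fin m → ℝ) (v : Fin n → ℝ) (Q : Matrix (Fin n) (Fin m) ℝ) :
    (vecMulVec u v * Q).trace = v ⬝ᵥ Q *ᵥ u := by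
  rw [vecMulVec_mul, trace_vecMulVec, dotProduct_mulVec, dotProduct_comm]

theorem exists_rep {m n : ℕ} (g : Matrix (Fin m) (Fin n) ℝ →ₗ[ℝ] ℝ) :
    ∃ G : Matrix (Fin m) (Fin n) ℝ, ∀ W, g W = (Wᵀ * G).trace := by
  refine ⟨Matrix.of fun i j => g (single i j 1), fun W => ?_⟩
  conv_lhs => rw [matrix_eq_sum_single W]
  have : ∀ i j, single i j (W i j) = W i j • single i j (1:ℝ) := by
    intro i j; simp
  simp only [map_sum, this, map_smul, smul_eq_mul, trace, diag, mul_apply, transpose_apply, of_apply]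
  rw [Finset.sum_comm]

theorem cvx_zero {E : Type*} [AddCommGroup E] [Module ℝ E] [TopologicalSpace E] (C : Set E) :
    (0:E) ∈ cvx C := subset_closure (subset_convexHull ℝ _ (mem_insert _ _))

theorem cvx_sub {E : Type*} [AddCommGroup E] [Module ℝ E] [TopologicalSpace E] {C D : Set E}
    (h0 : 0 ∈ D) (hC : C ⊆ D) (hc : Convex ℝ D) (hd : IsClosed D) : cvx C ⊆ D :=
  closure_minimal (convexHull_min (insert_subset h0 hC) hc) hd

theorem cvx_convex {m n : ℕ} (C : Set (Matrix (Fin m) (Fin n) ℝ)) : Convex ℝ (cvx C) :=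
  (convex_convexHull ℝ _).closure

theorem continuous_qf {m : ℕ} (Q : Matrix (Fin m) (Fin m) ℝ) :
    Continuous fun u : Fin m → ℝ => u ⬝ᵥ Q *ᵥ u := by
  fun_prop

theorem cvx_bound {m : ℕ} {U : Set (Fin m → ℝ)} {Q : Matrix (Fin m) (Fin m) ℝ} {a : ℝ}
    (ha : 0 ≤ a) (h : ∀ u ∈ U, u ⬝ᵥ Q *ᵥ u ≤ a) {M : Matrix (Fin m) (Fin m) ℝ}
    (hM : M ∈ cvx (PU U)) : (M * Q).trace ≤ a := by
  have hc : Convex ℝ {M : Matrix (Fin m) (Fin m) ℝ | (M * Q).trace ≤ a} := by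
    intro M hM N hN s t hs ht hst
    simp only [mem_ofPred_eq] at *
    simp only [add_mul, smul_mul, trace_add, trace_smul, smul_eq_mul]
    nlinarith
  refine cvx_sub (D := {M | (M * Q).trace ≤ a}) (by simpa using ha) ?_ hc ?_ hM
  · rintro _ ⟨u, hu, rfl⟩
    simp only [mem_ofPred_eq, tr_vec]
    exact h u hu
  · exact isClosed_le (by fun_prop) continuous_const

theorem cvx_symm {m : ℕ} {U : Set (Fin m → ℝ)} {M : Matrix (Fin m) (Fin m) ℝ}
    (hM : M ∈ cvx (PU U)) : M.IsSymm := by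
  refine cvx_sub (D := {M : Matrix (Fin m) (Fin m) ℝ | M.IsSymm}) ?_ ?_ ?_ ?_ hM
  · simp
  · rintro _ ⟨u, hu, rfl⟩
    simp [Matrix.IsSymm, transpose_vecMulVec]
  · intro M hM N hN s t hs ht hst
    simp only [mem_ofPred_eq, Matrix.IsSymm] at *
    simp [hM, hN]
  · exact isClosed_eq (by fun_prop) continuous_id

/-- bipolar theorem -/
theorem mem_cvx {m : ℕ} {U : Set (Fin m → ℝ)} {M : Matrix (Fin m) (Fin m) ℝ}
    (h : ∀ (Q : Matrix (Fin m) (Fin m) ℝ) (a : ℝ), 0 ≤ a → (∀ u ∈ U, u ⬝ᵥ Q *ᵥ u ≤ a) →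
      (M * Q).trace ≤ a) : M ∈ cvx (PU U) := by
  by_contra hM
  have := w_lcs m m
  obtain ⟨f, s, hf, hs⟩ := geometric_hahn_banach_closed_point (cvx_convex (PU U))
    isClosed_closure hM
  obtain ⟨G, hG⟩ := exists_rep (f : Matrix (Fin m) (Fin m) ℝ →ₗ[ℝ] ℝ)
  have hG' : ∀ W, f W = (W * Gᵀ).trace := by
    intro W
    have := hG W
    rw [← trace_transpose, transpose_mul, transpose_transpose, trace_mul_comm] at this
    exact this
  have h0 : 0 < s := by simpa using hf 0 (cvx_zero _)
  have := h Gᵀ s h0.le (fun u hu => by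
    rw [← tr_vec, ← hG']
    exact (hf _ (subset_closure (subset_convexHull ℝ _ (mem_insert_of_mem _ ⟨u, hu, rfl⟩)))).le)
  rw [← hG'] at this
  linarith

theorem cvx_box {m : ℕ} {U : Set (Fin m → ℝ)} (hU : IsCompact U) :
    ∃ R : ℝ, 0 ≤ R ∧ ∀ M ∈ cvx (PU U), ∀ i j, |M i j| ≤ R := by
  obtain ⟨ρ, hρ⟩ := hU.isBounded.exists_norm_le
  refine ⟨ρ^2, sq_nonneg _, fun M hM => ?_⟩
  refine cvx_sub (D := {M : Matrix (Fin m) (Fin m) ℝ | ∀ i j, |M i j| ≤ ρ^2}) ?_ ?_ ?_ ?_ hM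
  · intro i j
    simp [sq_nonneg]
  · rintro _ ⟨u, hu, rfl⟩ i j
    have h1 := (norm_le_pi_norm u i).trans (hρ u hu)
    have h2 := (norm_le_pi_norm u j).trans (hρ u hu)
    simp only [vecMulVec_apply, abs_mul, Real.norm_eq_abs] at *
    nlinarith [abs_nonneg (u i), abs_nonneg (u j)]
  · intro M hM N hN s t hs ht hst i j
    have h1 := abs_le.1 (hM i j)
    have h2 := abs_le.1 (hN i j)
    simp only [Matrix.add_apply, Matrix.smul_apply, smul_eq_mul]
    rw [abs_le]
    constructor <;> nlinarith
  · simp only [ofPred_forall]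
    exact isClosed_iInter fun i => isClosed_iInter fun j =>
      isClosed_le (by fun_prop) continuous_const

theorem blk_form {n d : ℕ} {M : Matrix (Fin n) (Fin n) ℝ} {X : Matrix (Fin n) (Fin d) ℝ}
    {N : Matrix (Fin d) (Fin d) ℝ} :
    (fromBlocks M X Xᵀ N).PosSemidef ↔ M.IsSymm ∧ N.IsSymm ∧
      ∀ x y, 0 ≤ x ⬝ᵥ M *ᵥ x + 2 * (x ⬝ᵥ X *ᵥ y) + y ⬝ᵥ N *ᵥ y := by
  have key : ∀ x y, (Sum.elim x y) ⬝ᵥ (fromBlocks M X Xᵀ N) *ᵥ (Sum.elim x y) =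
      x ⬝ᵥ M *ᵥ x + 2 * (x ⬝ᵥ X *ᵥ y) + y ⬝ᵥ N *ᵥ y := by
    intro x y
    have : y ⬝ᵥ Xᵀ *ᵥ x = x ⬝ᵥ X *ᵥ y := by
      rw [mulVec_transpose, dotProduct_comm, ← dotProduct_mulVec]
    rw [fromBlocks_mulVec, sumElim_dotProduct_sumElim, dotProduct_add, dotProduct_add]
    simp only [Sum.elim_comp_inl, Sum.elim_comp_inr, this]
    ring
  rw [posSemidef_iff_dotProduct_mulVec]
  constructor
  · rintro ⟨h1, h2⟩
    have h1' := h1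
    rw [Matrix.isHermitian_fromBlocks_iff] at h1'
    refine ⟨by simpa [Matrix.IsHermitian, Matrix.IsSymm, conjTranspose_eq_transpose_of_trivial] using h1'.1,
      by simpa [Matrix.IsHermitian, Matrix.IsSymm, conjTranspose_eq_transpose_of_trivial] using h1'.2.2.2, fun x y => ?_⟩
    rw [← key]
    simpa using h2 (Sum.elim x y)
  · rintro ⟨h1, h2, h3⟩
    constructor
    · rw [Matrix.isHermitian_fromBlocks_iff]
      simp only [Matrix.IsHermitian, conjTranspose_eq_transpose_of_trivial]
      exact ⟨h1, by simp, by simp, h2⟩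
    · intro x
      have := h3 (x ∘ Sum.inl) (x ∘ Sum.inr)
      rw [← key, Sum.elim_comp_inl_inr] at this
      simpa using this

open scoped MatrixOrder Matrix.Norms.L2Operator in
theorem blk_fact {n d : ℕ} {M : Matrix (Fin n) (Fin n) ℝ} {X : Matrix (Fin n) (Fin d) ℝ}
    {N : Matrix (Fin d) (Fin d) ℝ} (h : (fromBlocks M X Xᵀ N).PosSemidef) :
    ∃ (r : ℕ) (A : Matrix (Fin n) (Fin r) ℝ) (B : Matrix (Fin d) (Fin r) ℝ),
      X = A * Bᵀ ∧ M = A * Aᵀ ∧ N = B * Bᵀ := by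
  obtain ⟨B, hB⟩ : ∃ B : Matrix (Fin n ⊕ Fin d) (Fin n ⊕ Fin d) ℝ, fromBlocks M X Xᵀ N = Bᵀ * B := by
    obtain ⟨B, hB⟩ := CStarAlgebra.nonneg_iff_eq_star_mul_self.mp h.nonneg
    exact ⟨B, by rw [hB, star_eq_conjTranspose, conjTranspose_eq_transpose_of_trivial]⟩
  have e : ∀ i j, fromBlocks M X Xᵀ N i j = ∑ k : Fin (n+d), B (finSumFinEquiv.symm k) i * B (finSumFinEquiv.symm k) j := by
    intro i j
    rw [hB, mul_apply, ← finSumFinEquiv.symm.sum_comp]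
    rfl
  refine ⟨n + d, Matrix.of fun i k => B (finSumFinEquiv.symm k) (Sum.inl i),
    Matrix.of fun i k => B (finSumFinEquiv.symm k) (Sum.inr i), ?_, ?_, ?_⟩
  · ext i j
    simpa [mul_apply] using e (Sum.inl i) (Sum.inr j)
  · ext i j
    simpa [mul_apply] using e (Sum.inl i) (Sum.inl j)
  · ext i j
    simpa [mul_apply] using e (Sum.inr i) (Sum.inr j)

theorem fact_blk {n d r : ℕ} (A : Matrix (Fin n) (Fin r) ℝ) (B : Matrix (Fin d) (Fin r) ℝ) :
    (fromBlocks (A * Aᵀ) (A * Bᵀ) (A * Bᵀ)ᵀ (B * Bᵀ)).PosSemidef := by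
  rw [blk_form]
  refine ⟨by simp [Matrix.IsSymm], by simp [Matrix.IsSymm], fun x y => ?_⟩
  have e : ∀ {p q : ℕ} (C : Matrix (Fin p) (Fin r) ℝ) (D : Matrix (Fin q) (Fin r) ℝ) (x : Fin p → ℝ)
      (y : Fin q → ℝ), x ⬝ᵥ (C * Dᵀ) *ᵥ y = (Cᵀ *ᵥ x) ⬝ᵥ (Dᵀ *ᵥ y) := by
    intro p q C D x y
    rw [← mulVec_mulVec, dotProduct_mulVec, mulVec_transpose C]
  rw [e, e, e]
  have : 0 ≤ (Aᵀ *ᵥ x + Bᵀ *ᵥ y) ⬝ᵥ (Aᵀ *ᵥ x + Bᵀ *ᵥ y) := by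
    simpa using dotProduct_self_star_nonneg (Aᵀ *ᵥ x + Bᵀ *ᵥ y)
  simp only [dotProduct_add, add_dotProduct] at this
  rw [dotProduct_comm (Bᵀ *ᵥ y) (Aᵀ *ᵥ x)] at this
  linarith

theorem weak_dual {n d : ℕ} {M Q : Matrix (Fin n) (Fin n) ℝ} {X Y : Matrix (Fin n) (Fin d) ℝ}
    {N S : Matrix (Fin d) (Fin d) ℝ} (h : (fromBlocks M X Xᵀ N).PosSemidef)
    (h' : (fromBlocks Q Y Yᵀ S).PosSemidef) :
    2 * (Xᵀ * Y).trace ≤ (M * Q).trace + (N * S).trace := by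
  obtain ⟨r, A, B, rfl, rfl, rfl⟩ := blk_fact h
  have h'' := (blk_form.1 h').2.2
  have e : ∀ {p q : ℕ} (C : Matrix (Fin p) (Fin r) ℝ) (D : Matrix (Fin q) (Fin r) ℝ)
      (Q : Matrix (Fin q) (Fin p) ℝ),
      (C * Dᵀ * Q).trace = ∑ k, (fun i => D i k) ⬝ᵥ Q *ᵥ (fun i => C i k) := by
    intro p q C D Q
    rw [Matrix.mul_assoc, trace_mul_comm, Matrix.mul_assoc, trace]
    refine Finset.sum_congr rfl fun k _ => ?_
    simp only [diag, mul_apply, dotProduct, mulVec, transpose_apply]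
  rw [transpose_mul, transpose_transpose, e, e, e, Finset.mul_sum, ← Finset.sum_add_distrib]
  refine Finset.sum_le_sum fun k _ => ?_
  have := h'' (-(fun i => A i k)) (fun i => B i k)
  simp only [neg_dotProduct, mulVec_neg, dotProduct_neg, neg_neg] at this
  linarith

theorem blk_scale {n d : ℕ} {M : Matrix (Fin n) (Fin n) ℝ} {X : Matrix (Fin n) (Fin d) ℝ}
    {N : Matrix (Fin d) (Fin d) ℝ} (h : (fromBlocks M X Xᵀ N).PosSemidef) (p q : ℝ) :
    (fromBlocks (p ^ 2 • M) ((p * q) • X) ((p * q) • X)ᵀ (q ^ 2 • N)).PosSemidef := by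
  rw [blk_form] at *
  obtain ⟨h1, h2, h3⟩ := h
  refine ⟨h1.smul _, h2.smul _, fun x y => ?_⟩
  have := h3 (p • x) (q • y)
  simp only [mulVec_smul, smul_mulVec, dotProduct_smul, smul_dotProduct, smul_eq_mul] at *
  linarith

theorem blk_norm {n d : ℕ} {M : Matrix (Fin n) (Fin n) ℝ} {X : Matrix (Fin n) (Fin d) ℝ}
    {N : Matrix (Fin d) (Fin d) ℝ} {a b : ℝ} (ha : 0 < a) (hb : 0 < b)
    (h : (fromBlocks (a • M) X Xᵀ (b • N)).PosSemidef) :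
    (fromBlocks M ((√a * √b)⁻¹ • X) ((√a * √b)⁻¹ • X)ᵀ N).PosSemidef := by
  have := blk_scale h (√a)⁻¹ (√b)⁻¹
  rw [smul_smul, smul_smul, inv_pow, inv_pow, Real.sq_sqrt ha.le, Real.sq_sqrt hb.le,
    inv_mul_cancel₀ ha.ne', inv_mul_cancel₀ hb.ne', one_smul, one_smul, ← mul_inv] at this
  exact this

theorem amgm {a b : ℝ} (ha : 0 ≤ a) (hb : 0 ≤ b) : √a * √b ≤ (a + b) / 2 := by
  nlinarith [sq_nonneg (√a - √b), Real.sq_sqrt ha, Real.sq_sqrt hb]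

/-- The unit ball of `Θ̃`. -/
def KS {n d : ℕ} (U : Set (Fin n → ℝ)) (V : Set (Fin d → ℝ)) : Set (Matrix (Fin n) (Fin d) ℝ) :=
  {X | ∃ M ∈ cvx (PU U), ∃ N ∈ cvx (PU V), (fromBlocks M X Xᵀ N).PosSemidef}

theorem KS_zero {n d : ℕ} (U : Set (Fin n → ℝ)) (V : Set (Fin d → ℝ)) : 0 ∈ KS U V := by
  refine ⟨0, cvx_zero _, 0, cvx_zero _, ?_⟩
  rw [blk_form]
  simp

theorem KS_convex {n d : ℕ} (U : Set (Fin n → ℝ)) (V : Set (Fin d → ℝ)) : Convex ℝ (KS U V) := by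
  rintro X ⟨M, hM, N, hN, h⟩ X' ⟨M', hM', N', hN', h'⟩ s t hs ht hst
  refine ⟨s • M + t • M', cvx_convex _ hM hM' hs ht hst, s • N + t • N',
    cvx_convex _ hN hN' hs ht hst, ?_⟩
  rw [blk_form] at *
  obtain ⟨h1, h2, h3⟩ := h
  obtain ⟨h1', h2', h3'⟩ := h'
  refine ⟨(h1.smul _).add (h1'.smul _), (h2.smul _).add (h2'.smul _), fun x y => ?_⟩
  have e1 := mul_nonneg hs (h3 x y)
  have e2 := mul_nonneg ht (h3' x y)
  simp only [add_mulVec, smul_mulVec, dotProduct_smul, dotProduct_add, smul_eq_mul]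
  linarith

theorem KS_closed {n d : ℕ} {U : Set (Fin n → ℝ)} {V : Set (Fin d → ℝ)}
    (hU : IsCompact U) (hV : IsCompact V) : IsClosed (KS U V) := by
  obtain ⟨R, hR, hRU⟩ := cvx_box hU
  obtain ⟨T, hT, hTV⟩ := cvx_box hV
  have box : ∀ (m n : ℕ) (r : ℝ), IsCompact {M : Matrix (Fin m) (Fin n) ℝ | ∀ i j, |M i j| ≤ r} := by
    intro m n r
    have := isCompact_univ_pi (X := fun _ : Fin m => Fin n → ℝ) (s := fun _ => Set.univ.pi fun _ => Icc (-r) r)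
      (fun i => isCompact_univ_pi fun j => isCompact_Icc)
    have e : {M : Fin m → Fin n → ℝ | ∀ i j, |M i j| ≤ r} =
        Set.univ.pi fun _ => Set.univ.pi fun _ => Icc (-r) r := by
      ext M
      simp only [abs_le, Set.mem_pi, mem_univ, true_imp_iff, mem_Icc, mem_ofPred_eq]
    rw [← e] at this
    exact this
  have hA : IsCompact (cvx (PU U)) := (box n n R).of_isClosed_subset isClosed_closure hRU
  have hB : IsCompact (cvx (PU V)) := (box d d T).of_isClosed_subset isClosed_closure hTV
  let P : Set (Matrix (Fin n) (Fin n) ℝ × Matrix (Fin n) (Fin d) ℝ × Matrix (Fin d) (Fin d) ℝ) :=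
    (cvx (PU U) ×ˢ ({Z | ∀ i j, |Z i j| ≤ R + T} ×ˢ cvx (PU V))) ∩
      {p | ∀ x y, 0 ≤ x ⬝ᵥ p.1 *ᵥ x + 2 * (x ⬝ᵥ p.2.1 *ᵥ y) + y ⬝ᵥ p.2.2 *ᵥ y}
  have hP : IsCompact P := by
    refine (hA.prod ((box n d (R + T)).prod hB)).inter_right ?_
    simp only [ofPred_forall]
    exact isClosed_iInter fun x => isClosed_iInter fun y =>
      isClosed_le continuous_const (by fun_prop)
  have : KS U V = (fun p => p.2.1) '' P := by
    ext Z
    constructor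
    · rintro ⟨M, hM, N, hN, h⟩
      refine ⟨(M, Z, N), ⟨⟨hM, ?_, hN⟩, (blk_form.1 h).2.2⟩, rfl⟩
      intro i j
      have h3 := (blk_form.1 h).2.2
      have e1 := h3 (Pi.single i 1) (Pi.single j 1)
      have e2 := h3 (Pi.single i 1) (-Pi.single j 1)
      simp only [mulVec_neg, dotProduct_neg, neg_dotProduct, mulVec_single_one, single_one_dotProduct,
        Matrix.col_apply] at e1 e2
      have b1 := abs_le.1 (hRU M hM i i)
      have b2 := abs_le.1 (hTV N hN j j)
      simp only
      rw [abs_le]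
      constructor <;> linarith
    · rintro ⟨⟨M, Z, N⟩, ⟨⟨hM, -, hN⟩, h⟩, rfl⟩
      exact ⟨M, hM, N, hN, blk_form.2 ⟨cvx_symm hM, cvx_symm hN, h⟩⟩
  rw [this]
  exact (hP.image (by fun_prop)).isClosed

/-- values of the dual programme -/
def Val {n d : ℕ} (U : Set (Fin n → ℝ)) (V : Set (Fin d → ℝ))
    (W : Matrix (Fin n) (Fin n) ℝ × Matrix (Fin n) (Fin d) ℝ × Matrix (Fin d) (Fin d) ℝ) : Set ℝ :=
  {t | ∃ (Q : Matrix (Fin n) (Fin n) ℝ) (S : Matrix (Fin d) (Fin d) ℝ) (a b : ℝ), 0 ≤ a ∧ 0 ≤ b ∧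
    (∀ u ∈ U, u ⬝ᵥ Q *ᵥ u ≤ a) ∧ (∀ v ∈ V, v ⬝ᵥ S *ᵥ v ≤ b) ∧
    (∀ x y, x ⬝ᵥ W.1 *ᵥ x + 2 * (x ⬝ᵥ W.2.1 *ᵥ y) + y ⬝ᵥ W.2.2 *ᵥ y ≤ x ⬝ᵥ Q *ᵥ x + y ⬝ᵥ S *ᵥ y) ∧
    t = a + b}

theorem Val_nonneg {n d : ℕ} {U : Set (Fin n → ℝ)} {V : Set (Fin d → ℝ)} {W} {t : ℝ}
    (h : t ∈ Val U V W) : 0 ≤ t := by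
  obtain ⟨Q, S, a, b, ha, hb, -, -, -, rfl⟩ := h
  positivity

theorem Val_bdd {n d : ℕ} (U : Set (Fin n → ℝ)) (V : Set (Fin d → ℝ)) (W) : BddBelow (Val U V W) :=
  ⟨0, fun _ h => Val_nonneg h⟩

theorem exists_qf_bound {m : ℕ} {U : Set (Fin m → ℝ)} (hU : IsCompact U)
    (Q : Matrix (Fin m) (Fin m) ℝ) : ∃ a, 0 ≤ a ∧ ∀ u ∈ U, u ⬝ᵥ Q *ᵥ u ≤ a := by
  obtain ⟨a, ha⟩ := hU.bddAbove_image (continuous_qf Q).continuousOn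
  exact ⟨max a 0, le_max_right _ _, fun u hu => (ha ⟨u, hu, rfl⟩).trans (le_max_left _ _)⟩

theorem Val_nonempty {n d : ℕ} {U : Set (Fin n → ℝ)} {V : Set (Fin d → ℝ)}
    (hU : IsCompact U) (hV : IsCompact V) (W) : (Val U V W).Nonempty := by
  obtain ⟨P, Z, R⟩ := W
  obtain ⟨a, ha, ha'⟩ := exists_qf_bound hU (P + Z * Zᵀ)
  obtain ⟨b, hb, hb'⟩ := exists_qf_bound hV (R + 1)
  refine ⟨a + b, P + Z * Zᵀ, R + 1, a, b, ha, hb, ha', hb', fun x y => ?_, rfl⟩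
  have := (blk_form.1 (fact_blk Z (1 : Matrix (Fin d) (Fin d) ℝ))).2.2 (-x) y
  simp only [neg_dotProduct, mulVec_neg, dotProduct_neg, neg_neg, transpose_one, Matrix.mul_one,
    add_mulVec, dotProduct_add] at *
  linarith

theorem Val_add {n d : ℕ} {U : Set (Fin n → ℝ)} {V : Set (Fin d → ℝ)} {W W'} {t t' : ℝ}
    (h : t ∈ Val U V W) (h' : t' ∈ Val U V W') : t + t' ∈ Val U V (W + W') := by
  obtain ⟨Q, S, a, b, ha, hb, h1, h2, h3, rfl⟩ := h
  obtain ⟨Q', S', a', b', ha', hb', h1', h2', h3', rfl⟩ := h'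
  refine ⟨Q + Q', S + S', a + a', b + b', by positivity, by positivity, fun u hu => ?_,
    fun v hv => ?_, fun x y => ?_, by ring⟩
  · have := h1 u hu
    have := h1' u hu
    simp only [add_mulVec, dotProduct_add]
    linarith
  · have := h2 v hv
    have := h2' v hv
    simp only [add_mulVec, dotProduct_add]
    linarith
  · have := h3 x y
    have := h3' x y
    simp only [add_mulVec, dotProduct_add, Prod.fst_add, Prod.snd_add]
    linarith

theorem Val_smul {n d : ℕ} {U : Set (Fin n → ℝ)} {V : Set (Fin d → ℝ)} {W} {t c : ℝ} (hc : 0 < c)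
    (h : t ∈ Val U V W) : c * t ∈ Val U V (c • W) := by
  obtain ⟨Q, S, a, b, ha, hb, h1, h2, h3, rfl⟩ := h
  refine ⟨c • Q, c • S, c * a, c * b, by positivity, by positivity, fun u hu => ?_,
    fun v hv => ?_, fun x y => ?_, by ring⟩
  · have := mul_le_mul_of_nonneg_left (h1 u hu) hc.le
    simpa only [smul_mulVec, dotProduct_smul, smul_eq_mul]
  · have := mul_le_mul_of_nonneg_left (h2 v hv) hc.le
    simpa only [smul_mulVec, dotProduct_smul, smul_eq_mul]
  · have := mul_le_mul_of_nonneg_left (h3 x y) hc.le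
    simp only [smul_mulVec, dotProduct_smul, smul_eq_mul, Prod.smul_fst, Prod.smul_snd]
    linarith

theorem F_le_smul {n d : ℕ} {U : Set (Fin n → ℝ)} {V : Set (Fin d → ℝ)}
    (hU : IsCompact U) (hV : IsCompact V) (W) {c : ℝ} (hc : 0 < c) :
    sInf (Val U V (c • W)) ≤ c * sInf (Val U V W) := by
  rw [mul_comm, ← div_le_iff₀ hc]
  refine le_csInf (Val_nonempty hU hV W) fun t ht => ?_
  rw [div_le_iff₀ hc, mul_comm]
  exact csInf_le (Val_bdd _ _ _) (Val_smul hc ht)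

theorem F_smul {n d : ℕ} {U : Set (Fin n → ℝ)} {V : Set (Fin d → ℝ)}
    (hU : IsCompact U) (hV : IsCompact V) (c : ℝ) (hc : 0 < c) (W) :
    sInf (Val U V (c • W)) = c * sInf (Val U V W) := by
  refine le_antisymm (F_le_smul hU hV W hc) ?_
  have := F_le_smul hU hV (c • W) (inv_pos.2 hc)
  rw [smul_smul, inv_mul_cancel₀ hc.ne', one_smul] at this
  calc c * sInf (Val U V W) ≤ c * (c⁻¹ * sInf (Val U V (c • W))) := by gcongr
    _ = _ := by field_simp

theorem F_add {n d : ℕ} {U : Set (Fin n → ℝ)} {V : Set (Fin d → ℝ)}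
    (hU : IsCompact U) (hV : IsCompact V) (W W') :
    sInf (Val U V (W + W')) ≤ sInf (Val U V W) + sInf (Val U V W') := by
  rw [← sub_le_iff_le_add]
  refine le_csInf (Val_nonempty hU hV W) fun t ht => ?_
  rw [sub_le_iff_le_add, ← sub_le_iff_le_add']
  refine le_csInf (Val_nonempty hU hV W') fun t' ht' => ?_
  rw [sub_le_iff_le_add']
  exact csInf_le (Val_bdd _ _ _) (Val_add ht ht')

theorem F_nonneg {n d : ℕ} (U : Set (Fin n → ℝ)) (V : Set (Fin d → ℝ)) (W) :
    0 ≤ sInf (Val U V W) := Real.sInf_nonneg fun _ h => Val_nonneg h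

/-- Hahn-Banach: strong duality. -/
theorem exists_primal {n d : ℕ} {U : Set (Fin n → ℝ)} {V : Set (Fin d → ℝ)}
    (hU : IsCompact U) (hV : IsCompact V) (Y : Matrix (Fin n) (Fin d) ℝ) (hY : Y ≠ 0) :
    ∃ X ∈ KS U V, sInf (Val U V (0, Y, 0)) = 2 * (Xᵀ * Y).trace := by
  let w0 : Matrix (Fin n) (Fin n) ℝ × Matrix (Fin n) (Fin d) ℝ × Matrix (Fin d) (Fin d) ℝ :=
    (0, Y, 0)
  have hw0 : w0 ≠ 0 := fun h => hY (congrArg (fun p => p.2.1) h)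
  obtain ⟨g, hg1, hg2⟩ := exists_extension_of_le_sublinear
    (LinearPMap.mkSpanSingleton (K := ℝ) (σ := RingHom.id ℝ) w0 (sInf (Val U V w0)) hw0)
    (fun W => sInf (Val U V W)) (F_smul hU hV) (F_add hU hV) (by
      rintro ⟨x, hx⟩
      obtain ⟨c, rfl⟩ := Submodule.mem_span_singleton.1 hx
      rw [LinearPMap.mkSpanSingleton'_apply]
      simp only [RingHom.id_apply, smul_eq_mul]
      rcases lt_or_ge 0 c with hc | hc
      · rw [F_smul hU hV c hc]
      · exact (mul_nonpos_of_nonpos_of_nonneg hc (F_nonneg _ _ _)).trans (F_nonneg _ _ _))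
  have hgw : g w0 = sInf (Val U V w0) := by
    rw [← LinearPMap.mkSpanSingleton_apply ℝ ℝ (σ := RingHom.id ℝ) hw0 (sInf (Val U V w0)), ← hg1]
  have hgle : ∀ W t, t ∈ Val U V W → g W ≤ t := fun W t ht =>
    (hg2 W).trans (csInf_le (Val_bdd _ _ _) ht)
  obtain ⟨M, hM⟩ := exists_rep (g ∘ₗ LinearMap.inl ℝ _ _)
  obtain ⟨X, hX⟩ := exists_rep (g ∘ₗ LinearMap.inr ℝ _ _ ∘ₗ LinearMap.inl ℝ _ _)
  obtain ⟨N, hN⟩ := exists_rep (g ∘ₗ LinearMap.inr ℝ _ _ ∘ₗ LinearMap.inr ℝ _ _)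
  have tsw : ∀ {p q : ℕ} (A B : Matrix (Fin p) (Fin q) ℝ), (Aᵀ * B).trace = (Bᵀ * A).trace := by
    intro p q A B
    rw [← trace_transpose, transpose_mul, transpose_transpose]
  have hsplit : ∀ P Z R, g (P, Z, R) = (Mᵀ * P).trace + (Xᵀ * Z).trace + (Nᵀ * R).trace := by
    intro P Z R
    have e1 := hM P
    have e2 := hX Z
    have e3 := hN R
    rw [tsw] at e1 e2 e3
    rw [← e1, ← e2, ← e3]
    simp only [LinearMap.comp_apply, LinearMap.inl_apply, LinearMap.inr_apply, ← map_add]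
    simp
  have hMA : Mᵀ ∈ cvx (PU U) := by
    refine mem_cvx fun Q a ha h => ?_
    have := hgle (Q, 0, 0) a ⟨Q, 0, a, 0, ha, le_rfl, h, by simp, by simp, by simp⟩
    rw [hsplit] at this
    simpa using this
  have hNB : Nᵀ ∈ cvx (PU V) := by
    refine mem_cvx fun Q a ha h => ?_
    have := hgle (0, 0, Q) a ⟨0, Q, 0, a, le_rfl, ha, by simp, h, by simp, by simp⟩
    rw [hsplit] at this
    simpa using this
  have key : ∀ {p q : ℕ} (A : Matrix (Fin q) (Fin p) ℝ) (x : Fin p → ℝ) (y : Fin q → ℝ),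
      (A * vecMulVec x y).trace = y ⬝ᵥ A *ᵥ x := by
    intro p q A x y
    rw [trace_mul_comm, tr_vec]
  refine ⟨(2⁻¹ : ℝ) • X, ⟨Mᵀ, hMA, Nᵀ, hNB, blk_form.2 ⟨cvx_symm hMA, cvx_symm hNB, fun x y => ?_⟩⟩, ?_⟩
  · have := hgle (-vecMulVec x x, -vecMulVec x y, -vecMulVec y y) 0
      ⟨0, 0, 0, 0, le_rfl, le_rfl, by simp, by simp, fun a b => ?_, by simp⟩
    · rw [hsplit] at this
      simp only [Matrix.mul_neg, trace_neg, key] at this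
      simp only [smul_mulVec, dotProduct_smul, smul_eq_mul]
      have e : y ⬝ᵥ Xᵀ *ᵥ x = x ⬝ᵥ X *ᵥ y := by
        rw [mulVec_transpose, dotProduct_comm, ← dotProduct_mulVec]
      rw [e] at this
      linarith
    · simp only [neg_mulVec, dotProduct_neg, vecMulVec_mulVec, zero_mulVec, dotProduct_zero]
      simp only [op_smul_eq_smul, dotProduct_smul, smul_eq_mul]
      rw [dotProduct_comm a x, dotProduct_comm b y]
      nlinarith [sq_nonneg (x ⬝ᵥ a + y ⬝ᵥ b)]
  · rw [← hgw, hsplit]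
    simp

theorem tr_swap {p q : ℕ} (A B : Matrix (Fin p) (Fin q) ℝ) : (Aᵀ * B).trace = (Bᵀ * A).trace := by
  rw [← trace_transpose, transpose_mul, transpose_transpose]

theorem qf_transpose {m : ℕ} (Q : Matrix (Fin m) (Fin m) ℝ) (x : Fin m → ℝ) :
    x ⬝ᵥ Qᵀ *ᵥ x = x ⬝ᵥ Q *ᵥ x := by
  rw [mulVec_transpose, dotProduct_comm, ← dotProduct_mulVec]

theorem qf_sym {m : ℕ} (Q : Matrix (Fin m) (Fin m) ℝ) (x : Fin m → ℝ) :
    x ⬝ᵥ ((2⁻¹ : ℝ) • (Q + Qᵀ)) *ᵥ x = x ⬝ᵥ Q *ᵥ x := by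
  simp only [smul_mulVec, add_mulVec, dotProduct_smul, dotProduct_add, qf_transpose, smul_eq_mul]
  ring

theorem sym_sym {m : ℕ} (Q : Matrix (Fin m) (Fin m) ℝ) : ((2⁻¹ : ℝ) • (Q + Qᵀ)).IsSymm := by
  simp [Matrix.IsSymm, add_comm]

theorem mem_symPolar {m : ℕ} {U : Set (Fin m → ℝ)} {Q : Matrix (Fin m) (Fin m) ℝ} :
    Q ∈ symPolar (PU U) ↔ Q.IsSymm ∧ ∀ u ∈ U, u ⬝ᵥ Q *ᵥ u ≤ 1 := by
  simp [symPolar, PU, tr_vec]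

theorem mem_symPolar_of {m : ℕ} {U : Set (Fin m → ℝ)} {Q : Matrix (Fin m) (Fin m) ℝ} {a : ℝ}
    (ha : 0 < a) (h : ∀ u ∈ U, u ⬝ᵥ Q *ᵥ u ≤ a) :
    a⁻¹ • ((2⁻¹ : ℝ) • (Q + Qᵀ)) ∈ symPolar (PU U) := by
  rw [mem_symPolar]
  refine ⟨(sym_sym Q).smul _, fun u hu => ?_⟩
  rw [smul_mulVec, dotProduct_smul, qf_sym, smul_eq_mul, inv_mul_le_iff₀ ha, mul_one]
  exact h u hu

theorem strong {n d : ℕ} {U : Set (Fin n → ℝ)} {V : Set (Fin d → ℝ)}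
    (hU : IsCompact U) (hV : IsCompact V) {Y : Matrix (Fin n) (Fin d) ℝ} {c c' : ℝ}
    (h : ∀ X ∈ KS U V, (Xᵀ * Y).trace ≤ c) (hc : c < c') :
    ∃ Q ∈ symPolar (PU U), ∃ S ∈ symPolar (PU V), ∃ a b : ℝ, 0 < a ∧ 0 < b ∧ a + b < 2 * c' ∧
      (fromBlocks (a • Q) Y Yᵀ (b • S)).PosSemidef := by
  have h1 : sInf (Val U V (0, Y, 0)) < 2 * c' := by
    by_cases hY : Y = 0
    · have h0 : 0 ≤ c := by simpa using h 0 (KS_zero U V)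
      have : sInf (Val U V (0, Y, 0)) ≤ 0 := csInf_le (Val_bdd _ _ _)
        ⟨0, 0, 0, 0, le_rfl, le_rfl, by simp, by simp, by simp [hY], by simp⟩
      linarith
    · obtain ⟨X, hX, e⟩ := exists_primal hU hV Y hY
      rw [e]
      linarith [h X hX]
  obtain ⟨t, ⟨Q, S, a, b, ha, hb, hQ, hS, hf, rfl⟩, ht⟩ :=
    exists_lt_of_csInf_lt (Val_nonempty hU hV _) h1
  obtain ⟨ε, hε, hε'⟩ : ∃ ε > 0, a + ε + (b + ε) < 2 * c' :=
    ⟨(2 * c' - (a + b)) / 4, by linarith, by linarith⟩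
  refine ⟨_, mem_symPolar_of (a := a + ε) (by positivity) (fun u hu => (hQ u hu).trans (by linarith)),
    _, mem_symPolar_of (a := b + ε) (by positivity) (fun u hu => (hS u hu).trans (by linarith)),
    a + ε, b + ε, by positivity, by positivity, hε', ?_⟩
  rw [smul_inv_smul₀ (by positivity), smul_inv_smul₀ (by positivity), blk_form]
  refine ⟨sym_sym Q, sym_sym S, fun x y => ?_⟩
  rw [qf_sym, qf_sym]
  have := hf (-x) y
  simp only [neg_dotProduct, mulVec_neg, dotProduct_neg, neg_neg, zero_mulVec, dotProduct_zero] at this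
  linarith

theorem gauge_le {m : ℕ} {C : Set (Matrix (Fin m) (Fin m) ℝ)} {M : Matrix (Fin m) (Fin m) ℝ}
    (hM : M ∈ cvx C) (a : ℝ≥0) : gaugeE C ((a : ℝ) • M) ≤ a :=
  iInf₂_le a (smul_mem_smul_set hM)

theorem gauge_add_lt {m k : ℕ} {C : Set (Matrix (Fin m) (Fin m) ℝ)}
    {D : Set (Matrix (Fin k) (Fin k) ℝ)} {M : Matrix (Fin m) (Fin m) ℝ}
    {N : Matrix (Fin k) (Fin k) ℝ} {c : ℝ≥0∞} (h : (gaugeE C M + gaugeE D N) / 2 < c) :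
    ∃ r s : ℝ≥0, M ∈ (r : ℝ) • cvx C ∧ N ∈ (s : ℝ) • cvx D ∧ ((r : ℝ≥0∞) + s) / 2 < c := by
  rw [ENNReal.div_lt_iff (by simp) (by simp)] at h
  simp only [gaugeE, ENNReal.iInf_add, ENNReal.add_iInf, iInf_lt_iff] at h
  obtain ⟨s, hs, r, hr, h⟩ := h
  refine ⟨_, _, by assumption, by assumption, ?_⟩
  rw [ENNReal.div_lt_iff (by simp) (by simp)]
  assumption

theorem cvx_symPolar {m : ℕ} (U : Set (Fin m → ℝ)) : cvx (symPolar (PU U)) = symPolar (PU U) := by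
  refine Subset.antisymm (cvx_sub ?_ subset_rfl ?_ ?_) ?_
  · rw [mem_symPolar]
    simp
  · intro M hM N hN s t hs ht hst
    rw [mem_symPolar] at *
    refine ⟨(hM.1.smul _).add (hN.1.smul _), fun u hu => ?_⟩
    have h1 := hM.2 u hu
    have h2 := hN.2 u hu
    simp only [smul_mulVec, add_mulVec, dotProduct_smul, dotProduct_add, smul_eq_mul]
    nlinarith
  · have : symPolar (PU U) = {Q : Matrix (Fin m) (Fin m) ℝ | Qᵀ = Q} ∩
        ⋂ u ∈ U, {Q : Matrix (Fin m) (Fin m) ℝ | u ⬝ᵥ Q *ᵥ u ≤ 1} := by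
      ext Q
      rw [mem_symPolar]
      simp [Matrix.IsSymm]
    rw [this]
    exact (isClosed_eq (by fun_prop) continuous_id).inter
      (isClosed_biInter fun u _ => isClosed_le (by fun_prop) continuous_const)
  · exact fun x hx => subset_closure (subset_convexHull ℝ _ (mem_insert_of_mem _ hx))

theorem part1 {n d : ℕ} (U : Set (Fin n → ℝ)) (V : Set (Fin d → ℝ))
    (X : Matrix (Fin n) (Fin d) ℝ) :
    ThetaTilde U V X =
      ⨅ (M : Matrix (Fin n) (Fin n) ℝ) (N : Matrix (Fin d) (Fin d) ℝ)
        (_ : M.IsSymm) (_ : N.IsSymm) (_ : (fromBlocks M X Xᵀ N).PosSemidef),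
        (gaugeE (PU U) M + gaugeE (PU V) N) / 2 := by
  refine le_antisymm ?_ ?_
  · refine le_iInf fun M => le_iInf fun N => le_iInf fun _ => le_iInf fun _ => le_iInf fun h => ?_
    obtain ⟨r, A, B, e1, e2, e3⟩ := blk_fact h
    exact sInf_le ⟨r, A, B, e1, by rw [← e2, ← e3, add_comm]⟩
  · refine le_sInf ?_
    rintro t ⟨r, A, B, rfl, rfl⟩
    have h := fact_blk A B
    refine iInf_le_of_le (A * Aᵀ) (iInf_le_of_le (B * Bᵀ) (iInf_le_of_le (blk_form.1 h).1
      (iInf_le_of_le (blk_form.1 h).2.1 (iInf_le_of_le h ?_))))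
    rw [add_comm]

theorem Theta_le {n d : ℕ} {U : Set (Fin n → ℝ)} {V : Set (Fin d → ℝ)}
    {X : Matrix (Fin n) (Fin d) ℝ} (hX : X ∈ KS U V) (t : ℝ≥0) :
    ThetaTilde U V ((t : ℝ) • X) ≤ t := by
  obtain ⟨M, hM, N, hN, h⟩ := hX
  have h' := blk_scale h (√t) (√t)
  rw [Real.mul_self_sqrt t.coe_nonneg, Real.sq_sqrt t.coe_nonneg] at h'
  rw [part1]
  refine iInf_le_of_le _ (iInf_le_of_le _ (iInf_le_of_le (blk_form.1 h').1
      (iInf_le_of_le (blk_form.1 h').2.1 (iInf_le_of_le h' ?_))))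
  refine ENNReal.div_le_of_le_mul ?_
  rw [mul_two]
  exact add_le_add (gauge_le hM t) (gauge_le hN t)

theorem cvx_shrink {m : ℕ} {C : Set (Matrix (Fin m) (Fin m) ℝ)} {M : Matrix (Fin m) (Fin m) ℝ}
    {r : ℝ} (hr : 0 ≤ r) {ε : ℝ} (hε : 0 < ε) (h : M ∈ r • cvx C) :
    ∃ M' ∈ cvx C, M = (r + ε) • M' := by
  obtain ⟨M', hM', rfl⟩ := h
  have hp : 0 < r + ε := by positivity
  refine ⟨(r / (r + ε)) • M', ?_, ?_⟩
  · refine ((cvx_convex C).starConvex (cvx_zero C)).smul_mem hM' (by positivity) ?_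
    rw [div_le_one hp]
    linarith
  · simp only [smul_smul]
    rw [mul_div_cancel₀ _ hp.ne']

theorem KS_of_lt {n d : ℕ} {U : Set (Fin n → ℝ)} {V : Set (Fin d → ℝ)}
    {X : Matrix (Fin n) (Fin d) ℝ} {c : ℝ} (hX : ThetaTilde U V X < ENNReal.ofReal c) :
    c⁻¹ • X ∈ KS U V := by
  rw [part1] at hX
  simp only [iInf_lt_iff] at hX
  obtain ⟨M, N, -, -, h, hlt⟩ := hX
  obtain ⟨r, s, hr, hs, hrs⟩ := gauge_add_lt hlt
  have hrs' : ((r : ℝ) + s) / 2 < c := by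
    have h2 := (ENNReal.lt_ofReal_iff_toReal_lt hrs.ne_top).1 hrs
    simpa [ENNReal.toReal_add] using h2
  obtain ⟨ε, hε, hε'⟩ : ∃ ε > 0, ((r + ε) + (s + ε)) / 2 ≤ c :=
    ⟨c - (r + s) / 2, by linarith, by linarith⟩
  obtain ⟨M', hM', rfl⟩ := cvx_shrink r.2 hε hr
  obtain ⟨N', hN', rfl⟩ := cvx_shrink s.2 hε hs
  have hp : 0 < (r : ℝ) + ε := by have := r.2; positivity
  have hq : 0 < (s : ℝ) + ε := by have := s.2; positivity
  have hK : (√(r + ε) * √(s + ε))⁻¹ • X ∈ KS U V := ⟨M', hM', N', hN', blk_norm hp hq h⟩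
  have hle := (amgm hp.le hq.le).trans hε'
  have hpos : 0 < √(r + ε) * √(s + ε) := by positivity
  have hcpos : 0 < c := hpos.trans_le hle
  have := ((KS_convex U V).starConvex (KS_zero U V)).smul_mem hK
    (t := (√(r + ε) * √(s + ε)) / c) (by positivity) (by rwa [div_le_one hcpos])
  rw [smul_smul] at this
  convert this using 2
  field_simp

theorem Theta_le_one {n d : ℕ} {U : Set (Fin n → ℝ)} {V : Set (Fin d → ℝ)}
    (hU : IsCompact U) (hV : IsCompact V)
    (X : Matrix (Fin n) (Fin d) ℝ) : ThetaTilde U V X ≤ 1 ↔ X ∈ KS U V := by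
  constructor
  · intro h
    have hc : ContinuousAt (fun c : ℝ => c⁻¹ • X) 1 :=
      (continuousAt_inv₀ one_ne_zero).smul continuousAt_const
    have ht : Filter.Tendsto (fun c : ℝ => c⁻¹ • X) (nhdsWithin 1 (Ioi 1)) (nhds X) := by
      have := hc.tendsto.mono_left (nhdsWithin_le_nhds (s := Ioi 1))
      simpa using this
    refine (KS_closed hU hV).mem_of_tendsto ht ?_
    filter_upwards [self_mem_nhdsWithin] with c hc
    refine KS_of_lt (h.trans_lt ?_)
    rw [← ENNReal.ofReal_one]
    exact (ENNReal.ofReal_lt_ofReal_iff (zero_lt_one.trans hc)).2 hc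
  · intro h
    simpa using Theta_le h 1

theorem weak_polar {n d : ℕ} {U : Set (Fin n → ℝ)} {V : Set (Fin d → ℝ)}
    {X Y : Matrix (Fin n) (Fin d) ℝ} (hX : X ∈ KS U V) {Q : Matrix (Fin n) (Fin n) ℝ}
    {S : Matrix (Fin d) (Fin d) ℝ} {a b : ℝ} (ha : 0 ≤ a) (hb : 0 ≤ b)
    (hQ : Q ∈ a • symPolar (PU U)) (hS : S ∈ b • symPolar (PU V))
    (h : (fromBlocks Q Y Yᵀ S).PosSemidef) : (Xᵀ * Y).trace ≤ (a + b) / 2 := by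
  obtain ⟨M, hM, N, hN, h'⟩ := hX
  obtain ⟨Q, hQ, rfl⟩ := hQ
  obtain ⟨S, hS, rfl⟩ := hS
  have := weak_dual h' h
  have e1 := cvx_bound zero_le_one (mem_symPolar.1 hQ).2 hM
  have e2 := cvx_bound zero_le_one (mem_symPolar.1 hS).2 hN
  simp only [Matrix.mul_smul, trace_smul, smul_eq_mul] at this
  nlinarith

/-- Semidefinite representations of `Θ̃` and its polar `Θ̃°`, via block matrices
`[[M, X], [Xᵀ, N]] ⪰ 0`, the gauges of `P_U`, `P_V`, of their polars, and the bipolar sets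
`P_U°°`, `P_V°°` (closed convex hulls). -/
theorem statement12 {n d : ℕ} (U : Set (Fin n → ℝ)) (V : Set (Fin d → ℝ))
    (hU : IsCompact U) (hV : IsCompact V)
    (hU0 : (0 : Fin n → ℝ) ∈ convexHull ℝ U) (hV0 : (0 : Fin d → ℝ) ∈ convexHull ℝ V)
    (X Y : Matrix (Fin n) (Fin d) ℝ) :
    (ThetaTilde U V X =
      ⨅ (M : Matrix (Fin n) (Fin n) ℝ) (N : Matrix (Fin d) (Fin d) ℝ)
        (_ : M.IsSymm) (_ : N.IsSymm) (_ : (fromBlocks M X Xᵀ N).PosSemidef),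
        (gaugeE (PU U) M + gaugeE (PU V) N) / 2) ∧
    (ThetaTilde U V X =
      ⨆ Q ∈ symPolar (PU U), ⨆ S ∈ symPolar (PU V), ⨆ (Z : Matrix (Fin n) (Fin d) ℝ)
        (_ : (fromBlocks Q Z Zᵀ S).PosSemidef),
        ENNReal.ofReal ((Zᵀ * X).trace)) ∧
    (polarGauge (ThetaTilde U V) Y =
      ⨅ (Q : Matrix (Fin n) (Fin n) ℝ) (S : Matrix (Fin d) (Fin d) ℝ)
        (_ : Q.IsSymm) (_ : S.IsSymm) (_ : (fromBlocks Q Y Yᵀ S).PosSemidef),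
        (gaugeE (symPolar (PU U)) Q + gaugeE (symPolar (PU V)) S) / 2) ∧
    (polarGauge (ThetaTilde U V) Y =
      ⨆ M ∈ cvx (PU U), ⨆ N ∈ cvx (PU V), ⨆ (Z : Matrix (Fin n) (Fin d) ℝ)
        (_ : (fromBlocks M Z Zᵀ N).PosSemidef),
        ENNReal.ofReal ((Zᵀ * Y).trace)) := by
  refine ⟨part1 U V X, ?_, ?_, ?_⟩
  · refine le_antisymm ?_ ?_
    · refine le_of_forall_lt fun t ht => ?_
      lift t to ℝ≥0 using ht.ne_top
      obtain ⟨t', htt', ht'⟩ := ENNReal.lt_iff_exists_nnreal_btwn.1 ht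
      refine lt_of_lt_of_le htt' ?_
      have hpos : 0 < (t' : ℝ) := by
        have : t < t' := by exact_mod_cast htt'
        exact_mod_cast (zero_le (a := t)).trans_lt this
      have hn : (t' : ℝ)⁻¹ • X ∉ KS U V := by
        intro hK
        have := Theta_le hK t'
        rw [smul_inv_smul₀ hpos.ne'] at this
        exact absurd this (not_le.2 ht')
      have := w_lcs n d
      obtain ⟨f, s, hf, hs⟩ := geometric_hahn_banach_closed_point (KS_convex U V)
        (KS_closed hU hV) hn
      obtain ⟨G, hG⟩ := exists_rep (f : Matrix (Fin n) (Fin d) ℝ →ₗ[ℝ] ℝ)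
      have hG' : ∀ W, f W = (Wᵀ * G).trace := hG
      obtain ⟨s', hs1, hs2⟩ := exists_between hs
      obtain ⟨Q, hQ, S, hS, a, b, ha, hb, hab, hblk⟩ := strong hU hV
        (fun W hW => by rw [← hG']; exact (hf W hW).le) hs1
      have hblk' := blk_norm ha hb hblk
      refine le_iSup₂_of_le Q hQ (le_iSup₂_of_le S hS (le_iSup₂_of_le _ hblk' ?_))
      have hle : √a * √b ≤ s' := (amgm ha.le hb.le).trans (by linarith)
      have hp : 0 < √a * √b := by positivity
      have : (t' : ℝ) ≤ (((√a * √b)⁻¹ • G)ᵀ * X).trace := by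
        rw [transpose_smul, smul_mul, trace_smul, smul_eq_mul, tr_swap, ← div_eq_inv_mul,
          le_div_iff₀ hp]
        rw [hG', transpose_smul, smul_mul, trace_smul, smul_eq_mul, ← div_eq_inv_mul,
          lt_div_iff₀ hpos] at hs2
        nlinarith
      calc (t' : ℝ≥0∞) = ENNReal.ofReal (t' : ℝ) := by simp
        _ ≤ _ := ENNReal.ofReal_le_ofReal this
    · refine iSup₂_le fun Q hQ => iSup₂_le fun S hS => iSup₂_le fun Z hZ => ?_
      refine le_of_forall_gt fun c hc => ?_
      obtain ⟨c', hc1, hc2⟩ := ENNReal.lt_iff_exists_nnreal_btwn.1 hc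
      refine lt_of_le_of_lt ?_ hc2
      have hcp : 0 < (c' : ℝ) := by
        exact_mod_cast (zero_le (a := ThetaTilde U V X)).trans_lt hc1
      have hK : (c' : ℝ)⁻¹ • X ∈ KS U V := KS_of_lt (by simpa using hc1)
      have := weak_polar hK zero_le_one zero_le_one (by simpa using hQ) (by simpa using hS) hZ
      rw [transpose_smul, smul_mul, trace_smul, smul_eq_mul, tr_swap, inv_mul_le_iff₀ hcp] at this
      refine ENNReal.ofReal_le_of_le_toReal ?_
      simp only [ENNReal.coe_toReal]
      linarith
  · refine le_antisymm ?_ ?_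
    · refine iSup₂_le fun W hW => le_iInf fun Q => le_iInf fun S => le_iInf fun _ =>
        le_iInf fun _ => le_iInf fun h => ?_
      replace hW := (Theta_le_one hU hV W).1 hW
      refine le_of_forall_gt fun c hc => ?_
      obtain ⟨r, s, hr, hs, hrs⟩ := gauge_add_lt hc
      rw [cvx_symPolar] at hr hs
      refine lt_of_le_of_lt ?_ hrs
      have := weak_polar hW r.2 s.2 hr hs h
      refine (ENNReal.ofReal_le_ofReal this).trans ?_
      rw [ENNReal.ofReal_div_of_pos two_pos, ENNReal.ofReal_add r.2 s.2]
      simp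
    · refine le_of_forall_gt fun c hc => ?_
      obtain ⟨c1, h1, hc'⟩ := ENNReal.lt_iff_exists_nnreal_btwn.1 hc
      obtain ⟨c2, h2, h3⟩ := ENNReal.lt_iff_exists_nnreal_btwn.1 hc'
      refine lt_of_le_of_lt ?_ h3
      have hb : ∀ W ∈ KS U V, (Wᵀ * Y).trace ≤ c1 := by
        intro W hW
        have : ENNReal.ofReal ((Wᵀ * Y).trace) ≤ c1 :=
          (le_iSup₂_of_le (f := fun W (_ : W ∈ {X | ThetaTilde U V X ≤ 1}) =>
            ENNReal.ofReal ((Wᵀ * Y).trace)) W ((Theta_le_one hU hV W).2 hW) le_rfl).trans h1.le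
        rw [← ENNReal.ofReal_coe_nnreal] at this
        exact (ENNReal.ofReal_le_ofReal_iff c1.2).1 this
      obtain ⟨Q, hQ, S, hS, a, b, ha, hb, hab, hblk⟩ := strong hU hV hb
        (show (c1 : ℝ) < c2 by exact_mod_cast h2)
      refine iInf_le_of_le _ (iInf_le_of_le _ (iInf_le_of_le (blk_form.1 hblk).1
        (iInf_le_of_le (blk_form.1 hblk).2.1 (iInf_le_of_le hblk ?_))))
      lift a to ℝ≥0 using ha.le
      lift b to ℝ≥0 using hb.le
      refine ENNReal.div_le_of_le_mul ?_
      rw [← cvx_symPolar] at hQ hS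
      refine (add_le_add (gauge_le hQ a) (gauge_le hS b)).trans ?_
      have : a + b ≤ c2 * 2 := by
        have : (a : ℝ) + b ≤ c2 * 2 := by linarith
        exact_mod_cast this
      exact_mod_cast this
  · refine le_antisymm ?_ ?_
    · refine iSup₂_le fun W hW => ?_
      obtain ⟨M, hM, N, hN, h⟩ := (Theta_le_one hU hV W).1 hW
      exact le_iSup₂_of_le M hM (le_iSup₂_of_le N hN (le_iSup₂_of_le W h le_rfl))
    · refine iSup₂_le fun M hM => iSup₂_le fun N hN => iSup₂_le fun Z hZ => ?_
      exact le_iSup₂_of_le (f := fun W (_ : W ∈ {X | ThetaTilde U V X ≤ 1}) =>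
            ENNReal.ofReal ((Wᵀ * Y).trace)) Z ((Theta_le_one hU hV Z).2 ⟨M, hM, N, hN, hZ⟩) le_rfl

end
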